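/- arXiv:1112.2822 — 6 statements merged into one kernel-verified Lean document; each statement's English description precedes it below -/
import Mathlib

section
/- If a flow has a virtual-waiting-delay (v.w.d) stochastic arrival curve λ ∈ 𝓕 with bounding function h ∈ 𝓕̄, then the flow has an inter-arrival-time (i.a.t) stochastic arrival curve λ with the same bounding function h, i.e. for all m, n ≥ 0 and x ≥ 0, P{a(m+n) − a(m) < [λ(n) − x]^+} ≤ h(x). -/
open MeasureTheory
open scoped ProbabilityTheory

/-- `𝓕` (ℕ-indexed curves): nonnegative wide-sense increasing functions. -/
def InF (f : ℕ → ℝ) : Prop := Monotone f ∧ ∀ n, 0 ≤ f n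

/-- `𝓕̄`: nonnegative wide-sense decreasing functions, extended by 1 on negatives. -/
def InFbar (f : ℝ → ℝ) : Prop := Antitone f ∧ (∀ x, 0 ≤ f x) ∧ ∀ x < 0, f x = 1

/-- If a flow has a v.w.d stochastic arrival curve `lam ∈ 𝓕` with bounding
function `h ∈ 𝓕̄`, then it has an i.a.t stochastic arrival curve `lam` with the same
bounding function `h`. -/
theorem vwd_implies_iat
    {Ω : Type*} [MeasureSpace Ω] [IsProbabilityMeasure (ℙ : Measure Ω)]
    (a : ℕ → Ω → ℝ) (ha : ∀ ω, Monotone fun n => a n ω)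
    (lam : ℕ → ℝ) (h : ℝ → ℝ) (hlam : InF lam) (hh : InFbar h)
    (hvwd : ∀ (n : ℕ) (x : ℝ), 0 ≤ x →
      ℙ {ω | (⨆ m : Fin (n + 1), (lam (n - (m : ℕ)) - (a n ω - a (m : ℕ) ω))) > x}
        ≤ ENNReal.ofReal (h x)) :
    ∀ (m n : ℕ) (x : ℝ), 0 ≤ x →
      ℙ {ω | a (m + n) ω - a m ω < max (lam n - x) 0} ≤ ENNReal.ofReal (h x) := by
  intro m n x hx
  refine (measure_mono fun ω hω => ?_).trans (hvwd (m + n) x hx)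
  have hmono : a m ω ≤ a (m + n) ω := ha ω (Nat.le_add_right m n)
  have hlt : a (m + n) ω - a m ω < lam n - x :=
    (lt_max_iff.mp hω).resolve_right (by linarith)
  have hle := le_ciSup
    (f := fun k : Fin (m + n + 1) => lam (m + n - (k : ℕ)) - (a (m + n) ω - a (k : ℕ) ω))
    (Set.finite_range _).bddAbove ⟨m, by omega⟩
  simp only [Nat.add_sub_cancel_left] at hle
  exact lt_of_lt_of_le (by linarith) hle
end

section
/- If a flow has an inter-arrival-time (i.a.t) stochastic arrival curve λ ∈ 𝓕 with bounding function h ∈ 𝓖̄, then for any η with 0 < η ≤ lim_{n→∞} λ(n)/n, the flow has a virtual-waiting-delay (v.w.d) stochastic arrival curve λ_{−η}(n) = [λ(n) − η·n]^+ with bounding function h_η(x) = min{ h(x) + (1/η)∫_x^∞ h(y) dy , 1 }, i.e. for all n ≥ 0 and x ≥ 0, P{sup_{0≤m≤n}(λ_{−η}(n−m) − (a(n) − a(m))) > x} ≤ h_η(x). -/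
open MeasureTheory
open scoped ProbabilityTheory

/-- Iterated tail integrals `(∫_x^∞ dy)^n f(y)`. -/
noncomputable def tailIter (f : ℝ → ℝ) : ℕ → ℝ → ℝ
  | 0 => f
  | n + 1 => fun x => ∫ y in Set.Ioi x, tailIter f n y

/-- `𝓖̄ ⊆ 𝓕̄`: functions all of whose iterated tail integrals are finite on `[0,∞)`. -/
def InGbar (f : ℝ → ℝ) : Prop :=
  InFbar f ∧ ∀ (n : ℕ) (x : ℝ), 0 ≤ x → MeasureTheory.IntegrableOn (tailIter f n) (Set.Ioi x)

/-- A right Riemann sum of a nonnegative antitone function is at most its tail integral. -/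
theorem sum_mul_le_setIntegral_Ioi {h : ℝ → ℝ} (hanti : Antitone h) (hnonneg : ∀ y, 0 ≤ h y)
    {x : ℝ} (hint : IntegrableOn h (Set.Ioi x)) {η : ℝ} (hη : 0 < η) (n : ℕ) :
    ∑ k ∈ Finset.range n, h (x + η * ((k + 1 : ℕ) : ℝ)) ≤ (1 / η) * ∫ y in Set.Ioi x, h y := by
  have hcomp : Antitone fun t : ℝ => h (x + η * t) := fun s t hst =>
    hanti (by gcongr)
  have hsum := AntitoneOn.sum_le_integral (x₀ := 0) (a := n) (hcomp.antitoneOn _)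
  have hsubst := intervalIntegral.integral_comp_add_mul (a := 0) (b := n) h hη.ne' x
  simp only [zero_add, mul_zero, add_zero, smul_eq_mul] at hsum hsubst
  rw [hsubst] at hsum
  refine hsum.trans ?_
  rw [one_div, intervalIntegral.integral_of_le (by simp only [le_add_iff_nonneg_right]; positivity)]
  refine mul_le_mul_of_nonneg_left ?_ (inv_nonneg.mpr hη.le)
  exact setIntegral_mono_set hint (Filter.Eventually.of_forall hnonneg)
    Set.Ioc_subset_Ioi_self.eventuallyLE

/-- If a flow has an i.a.t stochastic arrival curve `lam ∈ 𝓕` with bounding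
function `h ∈ 𝓖̄`, then for any `η` with `0 < η ≤ lim_{n→∞} lam n / n`, the flow has a v.w.d
stochastic arrival curve `lam₋η(n) = [lam(n) − η·n]⁺` with bounding function
`h_η(x) = min (h x + (1/η)∫_x^∞ h(y) dy) 1`. -/
theorem iat_implies_vwd
    {Ω : Type*} [MeasureSpace Ω] [IsProbabilityMeasure (ℙ : Measure Ω)]
    (a : ℕ → Ω → ℝ) (ha : ∀ ω, Monotone fun n => a n ω)
    (lam : ℕ → ℝ) (h : ℝ → ℝ) (hlam : InF lam) (hh : InGbar h)
    (hiat : ∀ (m n : ℕ) (x : ℝ), 0 ≤ x →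
      ℙ {ω | a (m + n) ω - a m ω < max (lam n - x) 0} ≤ ENNReal.ofReal (h x))
    (L : ℝ) (hL : Filter.Tendsto (fun n : ℕ => lam n / n) Filter.atTop (nhds L))
    (η : ℝ) (hη : 0 < η) (hηL : η ≤ L) :
    ∀ (n : ℕ) (x : ℝ), 0 ≤ x →
      ℙ {ω | (⨆ m : Fin (n + 1),
          (max (lam (n - (m : ℕ)) - η * ((n - (m : ℕ) : ℕ) : ℝ)) 0 - (a n ω - a (m : ℕ) ω))) > x}
        ≤ ENNReal.ofReal (min (h x + (1 / η) * ∫ y in Set.Ioi x, h y) 1) := by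
  intro n x hx
  obtain ⟨⟨hanti, hnonneg, -⟩, htail⟩ := hh
  have hint : IntegrableOn h (Set.Ioi x) := htail 0 x hx
  rw [ENNReal.ofReal_min, ENNReal.ofReal_one]
  refine le_min ?_ prob_le_one
  have hsub : {ω | (⨆ m : Fin (n + 1),
      (max (lam (n - (m : ℕ)) - η * ((n - (m : ℕ) : ℕ) : ℝ)) 0 - (a n ω - a (m : ℕ) ω))) > x} ⊆
      ⋃ k ∈ Finset.range (n + 1),
        {ω | a (n - k + k) ω - a (n - k) ω < max (lam k - (x + η * (k : ℝ))) 0} := by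
    intro ω hω
    obtain ⟨m, hm⟩ := exists_lt_of_lt_ciSup (show x < _ from hω)
    have hmn : (m : ℕ) ≤ n := Nat.lt_succ_iff.mp m.isLt
    have hmono : a (m : ℕ) ω ≤ a n ω := ha ω hmn
    simp only [Set.mem_iUnion, Set.mem_ofPred_eq, Finset.mem_range]
    refine ⟨n - m, by omega, ?_⟩
    rw [Nat.sub_sub_self hmn, Nat.add_sub_cancel' hmn]
    rcases max_cases (lam (n - (m : ℕ)) - η * ((n - (m : ℕ) : ℕ) : ℝ)) 0 with hc | hc
    · exact lt_max_of_lt_left (by linarith)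
    · linarith
  calc _ ≤ ∑ k ∈ Finset.range (n + 1),
        ℙ {ω | a (n - k + k) ω - a (n - k) ω < max (lam k - (x + η * (k : ℝ))) 0} :=
        (measure_mono hsub).trans (measure_biUnion_finset_le _ _)
    _ ≤ ∑ k ∈ Finset.range (n + 1), ENNReal.ofReal (h (x + η * (k : ℝ))) :=
        Finset.sum_le_sum fun k _ => hiat (n - k) k _ (by positivity)
    _ = ENNReal.ofReal (∑ k ∈ Finset.range (n + 1), h (x + η * (k : ℝ))) :=
        (ENNReal.ofReal_sum_of_nonneg fun _ _ => hnonneg _).symm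
    _ ≤ _ := by
        refine ENNReal.ofReal_le_ofReal ?_
        rw [Finset.sum_range_succ', Nat.cast_zero, mul_zero, add_zero, add_comm]
        gcongr
        exact sum_mul_le_setIntegral_Ioi hanti hnonneg hint hη n
end

section
/- If a system provides to its arrival process an inter-departure-time (i.d) stochastic service curve γ ∈ 𝓕 with bounding function j ∈ 𝓖̄, then for any η > 0 it provides to the arrival process an η-stochastic service curve γ with bounding function j_η(x) = min{ j(x) + (1/η)∫_x^∞ j(y) dy , 1 }, i.e. for all n ≥ 0 and x ≥ 0, P{sup_{0≤m≤n}(d(m) − (a ⊗̄ γ)(m) − η·(n−m)) > x} ≤ j_η(x). -/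
open MeasureTheory
open scoped ProbabilityTheory

/-- `(a ⊗̄ γ)(n) = sup_{0 ≤ m ≤ n} [a(m) + γ(n − m + 1)]`. -/
noncomputable def maxConv {Ω : Type*} (a : ℕ → Ω → ℝ) (γ : ℕ → ℝ) (n : ℕ) (ω : Ω) : ℝ :=
  ⨆ m : Fin (n + 1), (a (m : ℕ) ω + γ (n - (m : ℕ) + 1))

/-- The system provides an inter-departure-time (i.d) stochastic service curve `γ`
with bounding function `j`. -/
def IDSSC {Ω : Type*} [MeasureSpace Ω] (a d : ℕ → Ω → ℝ) (γ : ℕ → ℝ) (j : ℝ → ℝ) : Prop :=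
  ∀ (n : ℕ) (x : ℝ), 0 ≤ x →
    ℙ {ω | d n ω - maxConv a γ n ω > x} ≤ ENNReal.ofReal (j x)

/-- The system provides an `η`-stochastic service curve `γ` with bounding function `j`. -/
def EtaSSC {Ω : Type*} [MeasureSpace Ω] (a d : ℕ → Ω → ℝ) (γ : ℕ → ℝ) (η : ℝ)
    (j : ℝ → ℝ) : Prop :=
  ∀ (n : ℕ) (x : ℝ), 0 ≤ x →
    ℙ {ω | (⨆ m : Fin (n + 1),
        (d (m : ℕ) ω - maxConv a γ (m : ℕ) ω - η * ((n : ℝ) - (m : ℕ)))) > x}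
      ≤ ENNReal.ofReal (j x)

/-- Riemann-sum comparison: the values of a nonnegative antitone function along an arithmetic
progression are bounded by its first value plus the rescaled tail integral. -/
theorem sum_antitone_le_add_tail_integral {f : ℝ → ℝ} (hf : Antitone f) (hf0 : ∀ y, 0 ≤ f y)
    {x : ℝ} (hint : IntegrableOn f (Set.Ioi x)) {η : ℝ} (hη : 0 < η) (n : ℕ) :
    ∑ k ∈ Finset.range (n + 1), f (x + η * k) ≤ f x + (1 / η) * ∫ y in Set.Ioi x, f y := by
  have hanti : Antitone fun t : ℝ => f (x + η * t) := fun s t hst => hf (by gcongr)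
  have hsum := (hanti.antitoneOn (Set.Icc (0 : ℝ) (0 + n))).sum_le_integral
  have hle : x ≤ x + η * n := le_add_of_nonneg_right (by positivity)
  have htail : ∫ y in x..x + η * n, f y ≤ ∫ y in Set.Ioi x, f y := by
    rw [intervalIntegral.integral_of_le hle]
    exact setIntegral_mono_set hint (.of_forall hf0) Set.Ioc_subset_Ioi_self.eventuallyLE
  rw [intervalIntegral.integral_comp_add_mul f hη.ne' x] at hsum
  simp only [mul_zero, add_zero, zero_add, smul_eq_mul] at hsum
  rw [Finset.sum_range_succ', Nat.cast_zero, mul_zero, add_zero, add_comm (f x), one_div]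
  gcongr
  exact hsum.trans (by gcongr)

/-- An i.d stochastic service curve `γ ∈ 𝓕` with bounding function
`j ∈ 𝓖̄` is also, for every `η > 0`, an `η`-stochastic service curve with bounding
function `j_η(x) = min (j x + (1/η) ∫_x^∞ j(y) dy) 1`. -/
theorem id_implies_eta
    {Ω : Type*} [MeasureSpace Ω] [IsProbabilityMeasure (ℙ : Measure Ω)]
    (a d : ℕ → Ω → ℝ) (γ : ℕ → ℝ) (j : ℝ → ℝ)
    (hγ : InF γ) (hj : InGbar j)
    (hid : IDSSC a d γ j) :
    ∀ η : ℝ, 0 < η →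
      EtaSSC a d γ η (fun x => min (j x + (1 / η) * ∫ y in Set.Ioi x, j y) 1) := by
  intro η hη n x hx
  obtain ⟨⟨hanti, hnonneg, -⟩, hint⟩ := hj
  rw [ENNReal.ofReal_min, ENNReal.ofReal_one]
  refine le_min ?_ prob_le_one
  have hsub : {ω | (⨆ m : Fin (n + 1),
        (d (m : ℕ) ω - maxConv a γ (m : ℕ) ω - η * ((n : ℝ) - (m : ℕ)))) > x} ⊆
      ⋃ k ∈ Finset.range (n + 1), {ω | d (n - k) ω - maxConv a γ (n - k) ω > x + η * k} := by
    intro ω hω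
    obtain ⟨m, hm⟩ := exists_lt_of_lt_ciSup (Set.mem_ofPred_eq ▸ hω : _ > x)
    have hmn : (m : ℕ) ≤ n := Nat.lt_succ_iff.mp m.2
    simp only [Set.mem_iUnion, Finset.mem_range, Set.mem_ofPred_eq]
    refine ⟨n - m, by omega, ?_⟩
    rw [Nat.sub_sub_self hmn, Nat.cast_sub hmn]
    linarith
  calc _ ≤ ∑ k ∈ Finset.range (n + 1),
        ℙ {ω | d (n - k) ω - maxConv a γ (n - k) ω > x + η * k} :=
        (measure_mono hsub).trans (measure_biUnion_finset_le _ _)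
    _ ≤ ∑ k ∈ Finset.range (n + 1), ENNReal.ofReal (j (x + η * k)) :=
        Finset.sum_le_sum fun k _ => hid _ _ (by positivity)
    _ = ENNReal.ofReal (∑ k ∈ Finset.range (n + 1), j (x + η * k)) :=
        (ENNReal.ofReal_sum_of_nonneg fun k _ => hnonneg _).symm
    _ ≤ _ := ENNReal.ofReal_le_ofReal
        (sum_antitone_le_add_tail_integral hanti hnonneg (hint 0 x hx) hη n)
end

section
/- Consider a flow passing through N nodes connected in tandem, where the departure process of node k is the arrival process of node k+1. If for some η > 0 each node k = 1, ..., N provides to its input an η-stochastic service curve γ^k ∈ 𝓕 with bounding function j^k ∈ 𝓕̄, i.e. P{sup_{0≤m≤n}(d^k(m) − (a^k ⊗̄ γ^k)(m) − η·(n−m)) > x} ≤ j^k(x) for all n, x ≥ 0, then the whole system provides to the initial arrival process an inter-departure-time (i.d) stochastic service curve γ = γ^1 ⊗̄ γ^2_η ⊗̄ ··· ⊗̄ γ^N_{(N−1)η} with bounding function j = j^1 ⊗ j^2 ⊗ ··· ⊗ j^N, where γ^k_{(k−1)η}(n) = γ^k(n) + (k−1)·η·n for k = 2, ..., N. -/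
open MeasureTheory
open scoped ProbabilityTheory

/-- Max-plus convolution of service curves: `(f ⊗̄ g)(n) = sup_{0≤m≤n}[f(m) + g(n−m+1)]`. -/
noncomputable def sconv (f g : ℕ → ℝ) (n : ℕ) : ℝ :=
  ⨆ m : Fin (n + 1), (f (m : ℕ) + g (n - (m : ℕ) + 1))

/-- Left-associated fold of `⊗̄` over the curves `gs 0, gs 1, ..., gs k`. -/
noncomputable def sconvFold (gs : ℕ → ℕ → ℝ) : ℕ → ℕ → ℝ
  | 0 => gs 0
  | k + 1 => sconv (sconvFold gs k) (gs (k + 1))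

/-- Min-plus convolution of bounding functions: `(f ⊗ g)(x) = inf_{0≤y≤x}[f(y) + g(x−y)]`. -/
noncomputable def minConv (f g : ℝ → ℝ) (x : ℝ) : ℝ :=
  ⨅ y : Set.Icc (0 : ℝ) x, (f (y : ℝ) + g (x - (y : ℝ)))

/-- Left-associated fold of `⊗` over the bounding functions `fs 0, fs 1, ..., fs k`. -/
noncomputable def minConvFold (fs : ℕ → ℝ → ℝ) : ℕ → ℝ → ℝ
  | 0 => fs 0
  | k + 1 => minConv (minConvFold fs k) (fs (k + 1))

lemma le_maxConv {Ω : Type*} (a : ℕ → Ω → ℝ) (γ : ℕ → ℝ) {n m : ℕ} (h : m ≤ n) (ω : Ω) :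
    a m ω + γ (n - m + 1) ≤ maxConv a γ n ω :=
  le_ciSup (f := fun m : Fin (n + 1) => a (m : ℕ) ω + γ (n - (m : ℕ) + 1))
    (Set.finite_range _).bddAbove ⟨m, Nat.lt_succ_of_le h⟩

lemma maxConv_le {Ω : Type*} {a : ℕ → Ω → ℝ} {γ : ℕ → ℝ} {n : ℕ} {ω : Ω} {c : ℝ}
    (h : ∀ m ≤ n, a m ω + γ (n - m + 1) ≤ c) : maxConv a γ n ω ≤ c :=
  ciSup_le fun m => h m (Nat.le_of_lt_succ m.2)

lemma le_sconv (f g : ℕ → ℝ) {n m : ℕ} (h : m ≤ n) :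
    f m + g (n - m + 1) ≤ sconv f g n :=
  le_ciSup (f := fun m : Fin (n + 1) => f (m : ℕ) + g (n - (m : ℕ) + 1))
    (Set.finite_range _).bddAbove ⟨m, Nat.lt_succ_of_le h⟩

/-- Serving with `f` and then with `g` is dominated by serving with `f ⊗̄ g`. -/
lemma maxConv_add_le_maxConv_sconv {Ω : Type*} (a : ℕ → Ω → ℝ) (f g : ℕ → ℝ) {n l : ℕ}
    (h : l ≤ n) (ω : Ω) :
    maxConv a f l ω + g (n - l + 1) ≤ maxConv a (sconv f g) n ω := by
  rw [← le_sub_iff_add_le]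
  refine maxConv_le fun m hm => ?_
  have h₁ := le_maxConv a (sconv f g) (hm.trans h) ω
  have h₂ := le_sconv f g (show l - m + 1 ≤ n - m + 1 by omega)
  rw [show n - m + 1 - (l - m + 1) + 1 = n - l + 1 by omega] at h₂
  linarith

/-- The excess `sup_{0 ≤ m ≤ n} [d(m) − (a ⊗̄ γ)(m) − η (n − m)]` of a node. -/
noncomputable def etaExcess {Ω : Type*} (a d : ℕ → Ω → ℝ) (γ : ℕ → ℝ) (η : ℝ) (n : ℕ)
    (ω : Ω) : ℝ :=
  ⨆ m : Fin (n + 1), (d (m : ℕ) ω - maxConv a γ (m : ℕ) ω - η * ((n : ℝ) - (m : ℕ)))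

lemma le_maxConv_add_etaExcess {Ω : Type*} (a d : ℕ → Ω → ℝ) (γ : ℕ → ℝ) (η : ℝ) {n m : ℕ}
    (h : m ≤ n) (ω : Ω) :
    d m ω ≤ maxConv a γ m ω + η * ((n : ℝ) - m) + etaExcess a d γ η n ω := by
  have := le_ciSup (f := fun m : Fin (n + 1) =>
    d (m : ℕ) ω - maxConv a γ (m : ℕ) ω - η * ((n : ℝ) - (m : ℕ)))
    (Set.finite_range _).bddAbove ⟨m, Nat.lt_succ_of_le h⟩
  simp only at this
  unfold etaExcess
  linarith

lemma tandem_departure_le {Ω : Type*} (p : ℕ → ℕ → Ω → ℝ) (γ : ℕ → ℕ → ℝ) {η : ℝ}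
    (hη : 0 ≤ η) (n : ℕ) (ω : Ω) (k : ℕ) {m : ℕ} (hm : m ≤ n) :
    p (k + 1) m ω ≤
      maxConv (p 0) (sconvFold (fun k n => γ k n + (k : ℝ) * η * n) k) m ω
        + (k + 1) * η * ((n : ℝ) - m)
        + ∑ i ∈ Finset.range (k + 1), etaExcess (p i) (p (i + 1)) (γ i) η n ω := by
  induction k generalizing m with
  | zero =>
    simpa [sconvFold] using le_maxConv_add_etaExcess (p 0) (p 1) (γ 0) η hm ω
  | succ k ih =>
    rw [Finset.sum_range_succ]
    set S := ∑ i ∈ Finset.range (k + 1), etaExcess (p i) (p (i + 1)) (γ i) η n ω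
    set F := sconvFold (fun k n => γ k n + (k : ℝ) * η * n) k with hF
    have h₁ := le_maxConv_add_etaExcess (p (k + 1)) (p (k + 1 + 1)) (γ (k + 1)) η hm ω
    suffices h : maxConv (p (k + 1)) (γ (k + 1)) m ω ≤
        maxConv (p 0) (sconvFold (fun k n => γ k n + (k : ℝ) * η * n) (k + 1)) m ω
          + (k + 1) * η * ((n : ℝ) - m) + S by
      push_cast
      linarith
    refine maxConv_le fun l hl => ?_
    have h₂ := ih (hl.trans hm)
    have h₃ := maxConv_add_le_maxConv_sconv (p 0) F
      (fun n => γ (k + 1) n + ((k + 1 : ℕ) : ℝ) * η * n) hl ω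
    have h₄ : 0 ≤ ((k : ℝ) + 1) * η := by positivity
    push_cast [Nat.cast_sub hl] at h₃
    simp only [sconvFold, ← hF]
    push_cast
    linarith

lemma minConvFold_nonneg {fs : ℕ → ℝ → ℝ} {k : ℕ} (h : ∀ i ≤ k, ∀ x, 0 ≤ fs i x) (x : ℝ) :
    0 ≤ minConvFold fs k x := by
  induction k generalizing x with
  | zero => exact h 0 le_rfl x
  | succ k ih =>
    exact Real.iInf_nonneg fun y =>
      add_nonneg (ih (fun i hi => h i (hi.trans k.le_succ)) _) (h _ le_rfl _)

/-- A union bound for the tail of a sum, with no independence or measurability required. -/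
lemma measureReal_add_gt_le_minConv {Ω : Type*} [MeasurableSpace Ω] {μ : Measure Ω}
    [IsFiniteMeasure μ] {X Y : Ω → ℝ} {f g : ℝ → ℝ}
    (hX : ∀ x, 0 ≤ x → μ.real {ω | X ω > x} ≤ f x)
    (hY : ∀ x, 0 ≤ x → μ.real {ω | Y ω > x} ≤ g x) {x : ℝ} (hx : 0 ≤ x) :
    μ.real {ω | X ω + Y ω > x} ≤ minConv f g x := by
  have : Nonempty (Set.Icc (0 : ℝ) x) := ⟨⟨0, le_rfl, hx⟩⟩
  refine le_ciInf fun ⟨y, hy₀, hyx⟩ => ?_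
  have hsub : {ω | X ω + Y ω > x} ⊆ {ω | X ω > y} ∪ {ω | Y ω > x - y} := by
    intro ω hω
    by_contra! h
    simp only [Set.mem_union, Set.mem_ofPred_eq, not_or, not_lt, gt_iff_lt] at h hω
    linarith [h.1, h.2]
  calc μ.real {ω | X ω + Y ω > x}
      ≤ μ.real ({ω | X ω > y} ∪ {ω | Y ω > x - y}) := measureReal_mono hsub
    _ ≤ μ.real {ω | X ω > y} + μ.real {ω | Y ω > x - y} := measureReal_union_le _ _
    _ ≤ f y + g (x - y) := add_le_add (hX y hy₀) (hY _ (sub_nonneg.2 hyx))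

lemma measureReal_sum_gt_le_minConvFold {Ω : Type*} [MeasurableSpace Ω] {μ : Measure Ω}
    [IsFiniteMeasure μ] {X : ℕ → Ω → ℝ} {fs : ℕ → ℝ → ℝ} {k : ℕ}
    (h : ∀ i ≤ k, ∀ x, 0 ≤ x → μ.real {ω | X i ω > x} ≤ fs i x) {x : ℝ} (hx : 0 ≤ x) :
    μ.real {ω | ∑ i ∈ Finset.range (k + 1), X i ω > x} ≤ minConvFold fs k x := by
  induction k generalizing x with
  | zero => simpa [minConvFold] using h 0 le_rfl x hx
  | succ k ih =>
    simp only [Finset.sum_range_succ _ (k + 1)]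
    exact measureReal_add_gt_le_minConv
      (fun y hy => ih (fun i hi => h i (hi.trans k.le_succ)) hy) (h _ le_rfl) hx

/-- If each node `k = 0, ..., N−1` (0-indexed) of a tandem of `N` nodes
provides an `η`-stochastic service curve `γ k ∈ 𝓕` with bounding function `j k ∈ 𝓕̄` to
its input `p k` (with output `p (k+1)`), then the whole system provides to the initial
input `p 0` the i.d stochastic service curve `γ⁰ ⊗̄ γ¹_η ⊗̄ ⋯ ⊗̄ γ^{N−1}_{(N−1)η}` (with
`γᵏ_{kη}(n) = γᵏ(n) + k·η·n`) with bounding function `j⁰ ⊗ j¹ ⊗ ⋯ ⊗ j^{N−1}`. -/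
theorem concatenation_eta
    {Ω : Type*} [MeasureSpace Ω] [IsProbabilityMeasure (ℙ : Measure Ω)]
    (N : ℕ) (hN : 1 ≤ N)
    (p : ℕ → ℕ → Ω → ℝ)
    (γ : ℕ → ℕ → ℝ) (j : ℕ → ℝ → ℝ)
    (hγ : ∀ k < N, InF (γ k)) (hj : ∀ k < N, InFbar (j k))
    (η : ℝ) (hη : 0 < η)
    (hnode : ∀ k < N, EtaSSC (p k) (p (k + 1)) (γ k) η (j k)) :
    IDSSC (p 0) (p N)
      (sconvFold (fun k n => γ k n + (k : ℝ) * η * n) (N - 1))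
      (minConvFold j (N - 1)) := by
  obtain ⟨K, rfl⟩ : ∃ K, N = K + 1 := ⟨N - 1, by omega⟩
  intro n x hx
  simp only [Nat.add_sub_cancel]
  have hj₀ : ∀ i ≤ K, ∀ y, 0 ≤ j i y := fun i hi => (hj i (Nat.lt_succ_of_le hi)).2.1
  have htail : ∀ i ≤ K, ∀ y, 0 ≤ y →
      (ℙ : Measure Ω).real {ω | etaExcess (p i) (p (i + 1)) (γ i) η n ω > y} ≤ j i y :=
    fun i hi y hy => ENNReal.toReal_le_of_le_ofReal (hj₀ i hi y)
      (hnode i (Nat.lt_succ_of_le hi) n y hy)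
  rw [ENNReal.le_ofReal_iff_toReal_le (measure_ne_top _ _) (minConvFold_nonneg hj₀ x)]
  refine le_trans (measureReal_mono fun ω hω => ?_)
    (measureReal_sum_gt_le_minConvFold htail hx)
  have h := tandem_departure_le p γ hη.le n ω K le_rfl
  simp only [Set.mem_ofPred_eq, gt_iff_lt, sub_self, mul_zero, add_zero] at h hω ⊢
  linarith
end

section
/- (Arrival time of the aggregate of two flows.) Let two flows F1 and F2 with nondecreasing arrival-time sequences a1, a2 : ℕ → [0,∞) (with the convention a_i(n) = 0 for n < 0) be aggregated into one flow in FIFO order, so that the aggregate arrival-time sequence a(n) lists the multiset union of the values {a1(k) : k ≥ 0} ∪ {a2(k) : k ≥ 0} in nondecreasing order (a(n) is the (n+1)-th smallest element). Then for every n ≥ 0, a(n) = min_{0 ≤ m ≤ n+1} max[ a1(m−1), a2(n−m) ]; in particular a(0) = min[a1(0), a2(0)]. -/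
/-- Extension of a sequence by `0` on negative arguments. -/
def extSeq (f : ℕ → ℝ) : ℤ → ℝ := fun z => if z < 0 then 0 else f z.toNat

theorem Finset.exists_mem_le_of_lt_card {s : Finset ℕ} {k : ℕ} (h : k < s.card) :
    ∃ x ∈ s, k ≤ x := by
  by_contra! hs
  have hle := Finset.card_le_card (fun x hx => Finset.mem_range.2 (hs x hx) : s ⊆ Finset.range k)
  rw [Finset.card_range] at hle
  omega

theorem extSeq_natCast (f : ℕ → ℝ) (k : ℕ) : extSeq f (k : ℤ) = f k := by
  simp [extSeq]

theorem le_extSeq_of_lt {f : ℕ → ℝ} (hf : Monotone f) {i c : ℕ} (h : i < c) :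
    f i ≤ extSeq f ((c : ℤ) - 1) := by
  obtain ⟨d, rfl⟩ := Nat.exists_eq_add_of_lt h
  have hd : ((i + d + 1 : ℕ) : ℤ) - 1 = ((i + d : ℕ) : ℤ) := by push_cast; ring
  rw [hd, extSeq_natCast]
  exact hf (Nat.le_add_right i d)

theorem extSeq_card_sub_one_le {f : ℕ → ℝ} (hf : Monotone f) {B : ℝ} (hB : 0 ≤ B)
    (s : Finset ℕ) (hs : ∀ x ∈ s, f x ≤ B) : extSeq f ((s.card : ℤ) - 1) ≤ B := by
  rcases Nat.eq_zero_or_pos s.card with h | h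
  · simpa [extSeq, h] using hB
  · obtain ⟨x, hx, hle⟩ := Finset.exists_mem_le_of_lt_card (Nat.sub_lt h one_pos)
    rw [← Nat.cast_pred h, extSeq_natCast]
    exact (hf hle).trans (hs x hx)

/-- **Arrival time of the aggregate of two flows.** If the nondecreasing,
nonnegative arrival-time sequences `a1`, `a2` are merged in FIFO order into the
nondecreasing sequence `a` (a rearrangement of the disjoint union of the two sequences),
then `a(n) = min_{0 ≤ m ≤ n+1} max[a1(m−1), a2(n−m)]` for every `n`, with the convention
`a_i(k) = 0` for `k < 0`. -/
theorem aggregate_arrival_time_two_flows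
    (a1 a2 a : ℕ → ℝ)
    (h1 : Monotone a1) (h2 : Monotone a2)
    (hn1 : ∀ n, 0 ≤ a1 n) (hn2 : ∀ n, 0 ≤ a2 n)
    (ha : Monotone a)
    (σ : ℕ ≃ (ℕ ⊕ ℕ)) (hσ : ∀ n, a n = Sum.elim a1 a2 (σ n)) :
    ∀ n : ℕ,
      a n = ⨅ m : Fin (n + 2),
        max (extSeq a1 ((m : ℤ) - 1)) (extSeq a2 ((n : ℤ) - (m : ℤ))) := by
  intro n
  have hcast (m : ℕ) (hm : m < n + 2) : (n : ℤ) - m = ((n + 1 - m : ℕ) : ℤ) - 1 := by omega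
  apply le_antisymm
  · refine le_ciInf fun m => ?_
    rw [hcast m m.isLt]
    let s := (Finset.range m).disjSum (Finset.range (n + 1 - m))
    have hcard : n < (s.map σ.symm.toEmbedding).card := by
      simp only [s, Finset.card_map, Finset.card_disjSum, Finset.card_range]
      omega
    obtain ⟨k, hk, hnk⟩ := Finset.exists_mem_le_of_lt_card hcard
    refine (ha hnk).trans ?_
    obtain ⟨y, hy, rfl⟩ := Finset.mem_map.1 hk
    rw [hσ, Equiv.coe_toEmbedding, Equiv.apply_symm_apply]
    rcases y with i | j
    · exact le_max_of_le_left
        (le_extSeq_of_lt h1 (Finset.mem_range.1 (Finset.inl_mem_disjSum.1 hy)))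
    · exact le_max_of_le_right
        (le_extSeq_of_lt h2 (Finset.mem_range.1 (Finset.inr_mem_disjSum.1 hy)))
  · obtain ⟨s, hs, hle⟩ : ∃ s : Finset (ℕ ⊕ ℕ), s.card = n + 1 ∧
        ∀ y ∈ s, Sum.elim a1 a2 y ≤ a n := by
      refine ⟨(Finset.range (n + 1)).map σ.toEmbedding, by simp, fun y hy => ?_⟩
      obtain ⟨k, hk, rfl⟩ := Finset.mem_map.1 hy
      rw [Equiv.coe_toEmbedding, ← hσ]
      exact ha (Nat.le_of_lt_succ (Finset.mem_range.1 hk))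
    rw [← Finset.card_toLeft_add_card_toRight] at hs
    have hn : 0 ≤ a n := by
      rw [hσ]
      cases σ n with
      | inl i => exact hn1 i
      | inr j => exact hn2 j
    have hm : s.toLeft.card < n + 2 := by omega
    refine ciInf_le_of_le (Set.finite_range _).bddBelow ⟨s.toLeft.card, hm⟩ ?_
    have hr : n + 1 - s.toLeft.card = s.toRight.card := by omega
    rw [hcast _ hm, hr]
    exact max_le
      (extSeq_card_sub_one_le h1 hn _ fun x hx => hle _ (Finset.mem_toLeft.1 hx))
      (extSeq_card_sub_one_le h2 hn _ fun x hx => hle _ (Finset.mem_toRight.1 hx))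
end

section
/- (Arrival time of the aggregate of N flows.) Let N ≥ 2 flows F1, ..., FN with nondecreasing arrival-time sequences a_1, ..., a_N : ℕ → [0,∞) (with the convention a_i(n) = 0 for n < 0) be aggregated into one flow in FIFO order, so that the aggregate arrival-time sequence a(n) lists the multiset union of all values {a_i(k) : 1 ≤ i ≤ N, k ≥ 0} in nondecreasing order (a(n) is the (n+1)-th smallest element). Then for every n ≥ 0, a(n) = min over all nonnegative integers m_1, ..., m_N with m_1 + ··· + m_N = n+1 of max[ a_1(m_1 − 1), a_2(m_2 − 1), ..., a_N(m_N − 1) ]; in particular a(0) = min{a_1(0), a_2(0), ..., a_N(0)}. -/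
theorem Finset.exists_mem_of_lt_card {S : Finset ℕ} {n : ℕ} (h : n < S.card) :
    ∃ k ∈ S, n ≤ k := by
  by_contra! hS
  have hsub : S ⊆ Finset.range n := fun k hk => Finset.mem_range.2 (hS k hk)
  have := Finset.card_le_card hsub
  rw [Finset.card_range] at this
  omega

theorem le_iSup_extSeq_of_sum_eq {N : ℕ} {af : Fin N → ℕ → ℝ}
    (hmono : ∀ i, Monotone (af i)) {a : ℕ → ℝ} (ha : Monotone a)
    {σ : ℕ ≃ (Fin N × ℕ)} (hσ : ∀ n, a n = af (σ n).1 (σ n).2)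
    {n : ℕ} {m : Fin N → ℕ} (hm : ∑ i, m i = n + 1) :
    a n ≤ ⨆ i, extSeq (af i) ((m i : ℤ) - 1) := by
  let S : Finset ℕ :=
    (Finset.univ.sigma fun i => Finset.range (m i)).map
      ((Equiv.sigmaEquivProd (Fin N) ℕ).trans σ.symm).toEmbedding
  have hS : n < S.card := by simp [S, hm]
  obtain ⟨k, hkS, hnk⟩ := Finset.exists_mem_of_lt_card hS
  obtain ⟨⟨i, j⟩, hij, rfl⟩ := Finset.mem_map.1 hkS
  have hj : j < m i := by simpa using hij
  refine le_ciSup_of_le (Set.finite_range _).bddAbove i ?_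
  calc a n ≤ a (σ.symm (i, j)) := ha hnk
    _ = af i j := by simp [hσ]
    _ ≤ extSeq (af i) ((m i : ℤ) - 1) := by
      rw [extSeq, if_neg (by omega)]
      exact hmono i (by omega)

theorem exists_sum_eq_and_iSup_extSeq_le {N : ℕ} {af : Fin N → ℕ → ℝ}
    (hmono : ∀ i, Monotone (af i)) (hpos : ∀ i n, 0 ≤ af i n)
    {a : ℕ → ℝ} (ha : Monotone a)
    {σ : ℕ ≃ (Fin N × ℕ)} (hσ : ∀ n, a n = af (σ n).1 (σ n).2) (n : ℕ) :
    ∃ m : Fin N → ℕ, ∑ i, m i = n + 1 ∧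
      ⨆ i, extSeq (af i) ((m i : ℤ) - 1) ≤ a n := by
  let T : Fin N → Finset ℕ := fun i => {t ∈ Finset.range (n + 1) | (σ t).1 = i}
  have hn : 0 ≤ a n := hσ n ▸ hpos _ _
  refine ⟨fun i => (T i).card, ?_, Real.iSup_le (fun i => ?_) hn⟩
  · rw [← Finset.card_eq_sum_card_fiberwise (fun _ _ => Finset.mem_coe.2 (Finset.mem_univ _)),
      Finset.card_range]
  · simp only [extSeq]
    split_ifs with hneg
    · exact hn
    have hinj : Set.InjOn (fun t => (σ t).2) (T i) := by
      intro s hs t ht hst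
      simp only [T, Finset.coe_filter, Set.mem_ofPred_eq] at hs ht
      exact σ.injective (Prod.ext (hs.2.trans ht.2.symm) hst)
    have hcard : ((T i).card - 1 : ℤ).toNat < ((T i).image fun t => (σ t).2).card := by
      rw [Finset.card_image_of_injOn hinj]
      omega
    obtain ⟨k, hk, hle⟩ := Finset.exists_mem_of_lt_card hcard
    obtain ⟨t, ht, rfl⟩ := Finset.mem_image.1 hk
    obtain ⟨htn, rfl⟩ := Finset.mem_filter.1 ht
    calc af (σ t).1 _ ≤ af (σ t).1 (σ t).2 := hmono _ hle
      _ = a t := (hσ t).symm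
      _ ≤ a n := ha (Nat.lt_succ_iff.1 (Finset.mem_range.1 htn))

/-- **Arrival time of the aggregate of N flows.** If the nondecreasing,
nonnegative arrival-time sequences `af i`, `i = 1, ..., N` (`N ≥ 2`), are merged in FIFO
order into the nondecreasing sequence `a` (a rearrangement of the disjoint union of the
`N` sequences), then for every `n`,
`a(n) = min_{m₁+⋯+m_N = n+1} max_i a_i(m_i − 1)`, with the convention `a_i(k) = 0` for
`k < 0`. -/
theorem aggregate_arrival_time_N_flows
    (N : ℕ) (hN : 2 ≤ N)
    (af : Fin N → ℕ → ℝ)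
    (hmono : ∀ i, Monotone (af i)) (hpos : ∀ i n, 0 ≤ af i n)
    (a : ℕ → ℝ) (ha : Monotone a)
    (σ : ℕ ≃ (Fin N × ℕ)) (hσ : ∀ n, a n = af (σ n).1 (σ n).2) :
    ∀ n : ℕ,
      a n = sInf {v : ℝ | ∃ m : Fin N → ℕ, (∑ i, m i) = n + 1 ∧
        v = ⨆ i, extSeq (af i) ((m i : ℤ) - 1)} := by
  intro n
  obtain ⟨m, hm, hle⟩ := exists_sum_eq_and_iSup_extSeq_le hmono hpos ha hσ n
  have hlb : a n ∈ lowerBounds {v : ℝ | ∃ m : Fin N → ℕ, (∑ i, m i) = n + 1 ∧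
      v = ⨆ i, extSeq (af i) ((m i : ℤ) - 1)} := by
    rintro _ ⟨m, hm, rfl⟩
    exact le_iSup_extSeq_of_sum_eq hmono ha hσ hm
  exact le_antisymm (le_csInf ⟨_, m, hm, rfl⟩ hlb) (csInf_le_of_le ⟨_, hlb⟩ ⟨m, hm, rfl⟩ hle)
end
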